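/- arXiv:1511.05502 — 11 statements merged into one kernel-verified Lean document; each statement's English description precedes it below -/
import Mathlib

section
/- Let K be a field and a = (a0,a1,a2) ∈ K³. Then det M_{a,x} = a0a1a2(x0³+x1³+x2³) − (a0³+a1³+a2³)x0x1x2 in K[x0,x1,x2]; consequently M_{a,x}·adj(M_{a,x}) = adj(M_{a,x})·M_{a,x} = (a0a1a2(x0³+x1³+x2³) − (a0³+a1³+a2³)x0x1x2)·I₃, i.e. the pair (M_{a,x}, adj M_{a,x}) is a matrix factorization of this cubic polynomial. -/
open MvPolynomial Matrix

/-- The Moore matrix `M_{a,y}`: (i,j) entry is `a_{i+j} · y_{i-j}`, indices in `ℤ/3ℤ`. -/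
noncomputable def moore {K : Type*} [CommRing K] (a : Fin 3 → K)
    (y : Fin 3 → MvPolynomial (Fin 3) K) :
    Matrix (Fin 3) (Fin 3) (MvPolynomial (Fin 3) K) :=
  Matrix.of fun i j => MvPolynomial.C (a (i + j)) * y (i - j)

/-- The specialized Moore matrix `M_{a,b} ∈ Mat₃(K)`. -/
def mooreK {K : Type*} [CommRing K] (a b : Fin 3 → K) : Matrix (Fin 3) (Fin 3) K :=
  Matrix.of fun i j => a (i + j) * b (i - j)

/-- The Hesse cubic `f_λ = x0³ + x1³ + x2³ + λ·x0x1x2`. -/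
noncomputable def hesse {K : Type*} [CommRing K] (l : K) : MvPolynomial (Fin 3) K :=
  X 0 ^ 3 + X 1 ^ 3 + X 2 ^ 3 + MvPolynomial.C l * (X 0 * X 1 * X 2)

/-- The doubling vector `b(a)`. -/
def dbl {K : Type*} [CommRing K] (a : Fin 3 → K) : Fin 3 → K :=
  ![a 0 * (a 2 ^ 3 - a 1 ^ 3), a 2 * (a 1 ^ 3 - a 0 ^ 3), a 1 * (a 0 ^ 3 - a 2 ^ 3)]

/-- The involution `ι(a0,a1,a2) = (a0,a2,a1)`. -/
def iot {K : Type*} [CommRing K] (a : Fin 3 → K) : Fin 3 → K := ![a 0, a 2, a 1]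

theorem moore_det_and_matrix_factorization {K : Type*} [Field K] (a : Fin 3 → K) :
    (moore a fun i => X i).det =
        MvPolynomial.C (a 0 * a 1 * a 2) * (X 0 ^ 3 + X 1 ^ 3 + X 2 ^ 3) -
          MvPolynomial.C (a 0 ^ 3 + a 1 ^ 3 + a 2 ^ 3) * (X 0 * X 1 * X 2) ∧
    (moore a fun i => X i) * (moore a fun i => X i).adjugate =
        ((MvPolynomial.C (a 0 * a 1 * a 2) * (X 0 ^ 3 + X 1 ^ 3 + X 2 ^ 3) -
          MvPolynomial.C (a 0 ^ 3 + a 1 ^ 3 + a 2 ^ 3) * (X 0 * X 1 * X 2) :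
            MvPolynomial (Fin 3) K)) •
          (1 : Matrix (Fin 3) (Fin 3) (MvPolynomial (Fin 3) K)) ∧
    (moore a fun i => X i).adjugate * (moore a fun i => X i) =
        ((MvPolynomial.C (a 0 * a 1 * a 2) * (X 0 ^ 3 + X 1 ^ 3 + X 2 ^ 3) -
          MvPolynomial.C (a 0 ^ 3 + a 1 ^ 3 + a 2 ^ 3) * (X 0 * X 1 * X 2) :
            MvPolynomial (Fin 3) K)) •
          (1 : Matrix (Fin 3) (Fin 3) (MvPolynomial (Fin 3) K)) := by
  have hdet : (moore a fun i => X i).det =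
      MvPolynomial.C (a 0 * a 1 * a 2) * (X 0 ^ 3 + X 1 ^ 3 + X 2 ^ 3) -
        MvPolynomial.C (a 0 ^ 3 + a 1 ^ 3 + a 2 ^ 3) * (X 0 * X 1 * X 2) := by
    have h12 : (1 : Fin 3) + 2 = 0 := by decide
    have h21 : (2 : Fin 3) + 1 = 0 := by decide
    have h22 : (2 : Fin 3) + 2 = 1 := by decide
    have h11 : (1 : Fin 3) + 1 = 2 := by decide
    have d01 : (0 : Fin 3) - 1 = 2 := by decide
    have d02 : (0 : Fin 3) - 2 = 1 := by decide
    have d12 : (1 : Fin 3) - 2 = 2 := by decide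
    have d21 : (2 : Fin 3) - 1 = 1 := by decide
    simp only [Matrix.det_fin_three, moore, Matrix.of_apply, h12, h21, h22, h11, d01, d02, d12,
      d21, sub_self, sub_zero, add_zero, zero_add, map_add, map_mul, map_pow]
    ring
  exact ⟨hdet, by rw [Matrix.mul_adjugate, hdet], by rw [Matrix.adjugate_mul, hdet]⟩
end

section
/- Let K be a field, λ ∈ K, and a = (a0,a1,a2) ∈ K³ with f_λ(a0,a1,a2) = 0 and a0a1a2 ≠ 0. Then det M_{a,x} = a0a1a2·f_λ in K[x0,x1,x2]; in particular the Moore matrix M_{a,x} is a linear determinantal representation of the Hesse cubic f_λ (its determinant equals f_λ up to the nonzero scalar a0a1a2). -/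
open MvPolynomial Matrix

theorem moore_det_eq_hesse {K : Type*} [Field K] (l : K) (a : Fin 3 → K)
    (ha : MvPolynomial.eval a (hesse l) = 0) (hne : a 0 * a 1 * a 2 ≠ 0) :
    (moore a fun i => X i).det = MvPolynomial.C (a 0 * a 1 * a 2) * hesse l := by
  have h : (C (a 0) ^ 3 + C (a 1) ^ 3 + C (a 2) ^ 3 +
      C l * (C (a 0) * C (a 1) * C (a 2)) : MvPolynomial (Fin 3) K) = 0 := by
    simpa [hesse] using congrArg (C : K → MvPolynomial (Fin 3) K) ha
  have e1 : (1 + 1 : Fin 3) = 2 := rfl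
  have e2 : (1 + 2 : Fin 3) = 0 := rfl
  have e3 : (2 + 1 : Fin 3) = 0 := rfl
  have e4 : (2 + 2 : Fin 3) = 1 := rfl
  have e5 : (0 - 1 : Fin 3) = 2 := rfl
  have e6 : (0 - 2 : Fin 3) = 1 := rfl
  have e7 : (1 - 2 : Fin 3) = 2 := rfl
  have e8 : (2 - 1 : Fin 3) = 1 := rfl
  simp only [det_fin_three, moore, hesse, of_apply, C_mul, e1, e2, e3, e4, e5, e6, e7, e8,
    add_zero, zero_add, sub_zero, sub_self]
  linear_combination (-(X 0 * X 1 * X 2)) * h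
end

section
/- Let K be an algebraically closed field of characteristic ≠ 2,3 and λ ∈ K with λ³ + 27 ≠ 0. For all nonzero vectors a, b ∈ K³ with f_λ(a) = 0 and f_λ(b) = 0, the specialized Moore matrix M_{a,b} ∈ Mat₃(K) has rank exactly 2. -/
open MvPolynomial Matrix

theorem Matrix.rank_lt_card_of_det_eq_zero {n K : Type*} [Fintype n] [DecidableEq n] [Field K]
    {A : Matrix n n K} (h : A.det = 0) : A.rank < Fintype.card n := by
  by_contra! hr
  rw [Matrix.rank_eq_finrank_span_cols] at hr
  have hu := Matrix.linearIndependent_cols_iff_isUnit.mp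
    (linearIndependent_iff_card_le_finrank_span.mpr hr)
  exact ((Matrix.isUnit_iff_isUnit_det A).mp hu).ne_zero h

theorem Matrix.minor_eq_of_rank_lt_two {m n K : Type*} [Fintype n] [Field K]
    {A : Matrix m n K} (h : A.rank < 2) (i i' : m) (j j' : n) :
    A i j * A i' j' = A i j' * A i' j := by
  by_contra hne
  have hdet : (A.submatrix ![i, i'] ![j, j']).det ≠ 0 := by
    rw [Matrix.det_fin_two]
    simpa [sub_eq_zero] using hne
  have hle := A.rank_submatrix_le ![i, i'] ![j, j']
  rw [Matrix.rank_of_det_ne_zero hdet, Fintype.card_fin] at hle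
  omega

/-- A fixed point of the polar quadratic map `(yz : xz : xy) = (x² : y² : z²)` does not lie
on a smooth Hesse cubic. -/
theorem eq_zero_of_hesse_of_mul_eq_mul_sq {K : Type*} [Field K] {l t x y z : K}
    (hl : l ^ 3 + 27 ≠ 0) (h : x ^ 3 + y ^ 3 + z ^ 3 + l * (x * y * z) = 0)
    (hx : y * z = t * x ^ 2) (hy : z * x = t * y ^ 2) (hz : x * y = t * z ^ 2) :
    x = 0 ∧ y = 0 ∧ z = 0 := by
  by_cases hP : x * y * z = 0
  · have hxyz : x * y = 0 ∨ z * x = 0 := by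
      rcases mul_eq_zero.mp hP with h' | h' <;> simp [h']
    rcases hxyz with h' | h' <;> rcases mul_eq_zero.mp h' with h0 | h0 <;> subst h0 <;>
      simp_all <;> grind
  · have hlt : l * t = -3 := by
      apply mul_right_cancel₀ hP
      linear_combination t * h + x * hx + y * hy + z * hz
    have ht : t ^ 3 = 1 := by
      apply mul_right_cancel₀ (pow_ne_zero 2 hP)
      have : (y * z) * (z * x) * (x * y) = (t * x ^ 2) * (t * y ^ 2) * (t * z ^ 2) := by
        rw [hx, hy, hz]
      linear_combination -this
    refine absurd ?_ hl
    have : (l * t) ^ 3 = (-3) ^ 3 := by rw [hlt]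
    linear_combination this - l ^ 3 * ht

theorem eval_hesse {K : Type*} [CommRing K] (l : K) (a : Fin 3 → K) :
    MvPolynomial.eval a (hesse l) =
      a 0 ^ 3 + a 1 ^ 3 + a 2 ^ 3 + l * (a 0 * a 1 * a 2) := by
  simp [hesse]

theorem mooreK_eq {K : Type*} [CommRing K] (a b : Fin 3 → K) :
    mooreK a b = !![a 0 * b 0, a 1 * b 2, a 2 * b 1;
      a 1 * b 1, a 2 * b 0, a 0 * b 2; a 2 * b 2, a 0 * b 1, a 1 * b 0] := by
  ext i j
  fin_cases i <;> fin_cases j <;> rfl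

theorem det_mooreK {K : Type*} [CommRing K] (a b : Fin 3 → K) :
    (mooreK a b).det = a 0 * a 1 * a 2 * (b 0 ^ 3 + b 1 ^ 3 + b 2 ^ 3) -
      (a 0 ^ 3 + a 1 ^ 3 + a 2 ^ 3) * (b 0 * b 1 * b 2) := by
  rw [mooreK_eq, Matrix.det_fin_three]
  simp
  ring

/-- The `2 × 2` minors of the Moore matrix, in uniform notation. -/
theorem mul_sq_eq_of_rank_mooreK_lt_two {K : Type*} [Field K] {a b : Fin 3 → K}
    (h : (mooreK a b).rank < 2) (i k : Fin 3) :
    a (i + 1) * a (i + 2) * b k ^ 2 = a i ^ 2 * (b (k + 1) * b (k + 2)) := by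
  have hm := Matrix.minor_eq_of_rank_lt_two h
  simp only [mooreK, Matrix.of_apply] at hm
  have e := hm (2 * i + 2 * k + 1) (2 * i + 2 * k + 2) (2 * i + k + 1) (2 * i + k + 2)
  fin_cases i <;> fin_cases k <;> simp at e ⊢ <;> grind

theorem moore_specialized_rank_two {K : Type*} [Field K] [IsAlgClosed K]
    (h2 : (2 : K) ≠ 0) (h3 : (3 : K) ≠ 0)
    (l : K) (hl : l ^ 3 + 27 ≠ 0) (a b : Fin 3 → K) (ha0 : a ≠ 0) (hb0 : b ≠ 0)
    (ha : MvPolynomial.eval a (hesse l) = 0) (hb : MvPolynomial.eval b (hesse l) = 0) :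
    (mooreK a b).rank = 2 := by
  rw [eval_hesse] at ha hb
  have hdet : (mooreK a b).det = 0 := by
    rw [det_mooreK]
    linear_combination a 0 * a 1 * a 2 * hb - b 0 * b 1 * b 2 * ha
  have hlt := Matrix.rank_lt_card_of_det_eq_zero hdet
  rw [Fintype.card_fin] at hlt
  by_contra hne
  have hm := mul_sq_eq_of_rank_mooreK_lt_two (a := a) (b := b) (by omega)
  obtain ⟨k, hk⟩ := Function.ne_iff.mp hb0
  have key (i : Fin 3) :
      a (i + 1) * a (i + 2) = b (k + 1) * b (k + 2) / b k ^ 2 * a i ^ 2 := by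
    rw [div_mul_eq_mul_div, eq_div_iff (pow_ne_zero 2 hk), hm i k, mul_comm]
  obtain ⟨hx, hy, hz⟩ := eq_zero_of_hesse_of_mul_eq_mul_sq hl ha (key 0) (key 1) (key 2)
  apply ha0
  ext i
  fin_cases i <;> assumption
end

section
/- Let K be a field and a = (a0,a1,a2) ∈ K³. Then adj(M_{ι(a),a}) equals the outer product b(a)ᵀ·(0,−1,1) of the column vector b(a) = (a0(a2³−a1³), a2(a1³−a0³), a1(a0³−a2³)) with the row vector (0,−1,1). In particular det M_{ι(a),a} = 0 and M_{ι(a),a}·b(a)ᵀ = 0. -/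
open MvPolynomial Matrix

/-- `M_{ι(a),a}` written out; its last two rows coincide. -/
theorem mooreK_iot_self {K : Type*} [CommRing K] (a : Fin 3 → K) :
    mooreK (iot a) a =
      !![a 0 ^ 2, a 2 ^ 2, a 1 ^ 2;
         a 1 * a 2, a 0 * a 1, a 0 * a 2;
         a 1 * a 2, a 0 * a 1, a 0 * a 2] := by
  ext i j
  fin_cases i <;> fin_cases j <;>
    first
      | exact (sq _).symm
      | rfl
      | exact mul_comm _ _

theorem adjugate_moore_iota_self {K : Type*} [Field K] (a : Fin 3 → K) :
    (mooreK (iot a) a).adjugate = Matrix.vecMulVec (dbl a) ![0, -1, 1] ∧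
    (mooreK (iot a) a).det = 0 ∧
    (mooreK (iot a) a).mulVec (dbl a) = 0 := by
  rw [mooreK_iot_self]
  refine ⟨?_, ?_, ?_⟩
  · rw [adjugate_fin_three_of]
    ext i j
    fin_cases i <;> fin_cases j <;> simp [vecMulVec_apply, dbl] <;> ring
  · exact det_zero_of_row_eq (i := 1) (j := 2) (by decide) rfl
  · ext i
    fin_cases i <;> simp [mulVec, dotProduct, Fin.sum_univ_three, dbl] <;> ring
end

section
/- Let K be a field, a = (a0,a1,a2) ∈ K³, and b = b(a) = (a0(a2³−a1³), a2(a1³−a0³), a1(a0³−a2³)). Then adj(M_{ι(a),b}) equals the outer product cᵀ·(a0, a2, a1), where c is the column vector (a0a1a2(a0⁶+a1⁶+a2⁶ − a0³a1³ − a1³a2³ − a0³a2³), a0⁶a1³+a1⁶a2³+a2⁶a0³ − 3(a0a1a2)³, a0⁶a2³+a1⁶a0³+a2⁶a1³ − 3(a0a1a2)³). -/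
open MvPolynomial Matrix

theorem adjugate_moore_iota_dbl {K : Type*} [Field K] (a : Fin 3 → K) :
    (mooreK (iot a) (dbl a)).adjugate =
      Matrix.vecMulVec
        ![a 0 * a 1 * a 2 *
            (a 0 ^ 6 + a 1 ^ 6 + a 2 ^ 6 -
              a 0 ^ 3 * a 1 ^ 3 - a 1 ^ 3 * a 2 ^ 3 - a 0 ^ 3 * a 2 ^ 3),
          a 0 ^ 6 * a 1 ^ 3 + a 1 ^ 6 * a 2 ^ 3 + a 2 ^ 6 * a 0 ^ 3 -
            3 * (a 0 * a 1 * a 2) ^ 3,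
          a 0 ^ 6 * a 2 ^ 3 + a 1 ^ 6 * a 0 ^ 3 + a 2 ^ 6 * a 1 ^ 3 -
            3 * (a 0 * a 1 * a 2) ^ 3]
        ![a 0, a 2, a 1] := by
  ext i j
  rw [Matrix.adjugate_fin_three]
  have h11 : (1 + 1 : Fin 3) = 2 := rfl
  have h12 : (1 + 2 : Fin 3) = 0 := rfl
  have h21 : (2 + 1 : Fin 3) = 0 := rfl
  have h22 : (2 + 2 : Fin 3) = 1 := rfl
  have h01 : (0 - 1 : Fin 3) = 2 := rfl
  have h02 : (0 - 2 : Fin 3) = 1 := rfl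
  have h12' : (1 - 2 : Fin 3) = 2 := rfl
  have h21' : (2 - 1 : Fin 3) = 1 := rfl
  fin_cases i <;> fin_cases j <;>
    simp [mooreK, iot, dbl, Matrix.vecMulVec_apply, h11, h12, h21, h22, h01, h02, h12', h21'] <;>
    ring
end

section
/- Let K be an algebraically closed field of characteristic ≠ 3 and λ ∈ K with λ³ + 27 ≠ 0. A nonzero vector a = (a0,a1,a2) ∈ K³ satisfies f_λ(a) = 0 and a0a1a2 = 0 if and only if a is a nonzero scalar multiple of one of the nine vectors (1,−ω,0), (0,1,−ω), (−ω,0,1) with ω ∈ K satisfying ω³ = 1; that is, the points of the smooth Hesse cubic E = {f_λ = 0} lying on the triangle x0x1x2 = 0 are exactly these nine inflection points. -/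
open MvPolynomial Matrix

/-- Nontrivial zeros of `p³ + q³` have the form `q = -pω` with `ω³ = 1`. -/
lemma exists_cube_root_of_cube_add_cube_eq_zero {K : Type*} [Field K] {p q : K}
    (h : p ^ 3 + q ^ 3 = 0) (hpq : ¬(p = 0 ∧ q = 0)) :
    p ≠ 0 ∧ ∃ ω : K, ω ^ 3 = 1 ∧ q = p * -ω := by
  have hp : p ≠ 0 := by
    rintro rfl
    exact hpq ⟨rfl, by simpa using h⟩
  refine ⟨hp, -q / p, ?_, by field_simp⟩
  rw [div_pow, div_eq_one_iff_eq (pow_ne_zero 3 hp)]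
  linear_combination -h

theorem hesse_inflection_points {K : Type*} [Field K] [IsAlgClosed K] (h3 : (3 : K) ≠ 0)
    (l : K) (hl : l ^ 3 + 27 ≠ 0) (a : Fin 3 → K) (ha0 : a ≠ 0) :
    (MvPolynomial.eval a (hesse l) = 0 ∧ a 0 * a 1 * a 2 = 0) ↔
      ∃ μ : K, μ ≠ 0 ∧ ∃ ω : K, ω ^ 3 = 1 ∧
        (a = μ • ![1, -ω, 0] ∨ a = μ • ![0, 1, -ω] ∨ a = μ • ![-ω, 0, 1]) := by
  have heval : MvPolynomial.eval a (hesse l) =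
      a 0 ^ 3 + a 1 ^ 3 + a 2 ^ 3 + l * (a 0 * a 1 * a 2) := by
    simp [hesse]
  rw [heval]
  constructor
  · rintro ⟨hf, hprod⟩
    rw [hprod, mul_zero, add_zero] at hf
    have hne : ¬(a 0 = 0 ∧ a 1 = 0 ∧ a 2 = 0) := by
      rintro ⟨h₀, h₁, h₂⟩
      exact ha0 (by ext i; fin_cases i <;> assumption)
    rcases mul_eq_zero.mp hprod with h | h₂
    · rcases mul_eq_zero.mp h with h₀ | h₁
      · obtain ⟨hμ, ω, hω, h⟩ := exists_cube_root_of_cube_add_cube_eq_zero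
          (p := a 1) (q := a 2) (by simpa [h₀] using hf) (by tauto)
        refine ⟨a 1, hμ, ω, hω, Or.inr (Or.inl ?_)⟩
        ext i; fin_cases i <;> simp [h₀, h]
      · obtain ⟨hμ, ω, hω, h⟩ := exists_cube_root_of_cube_add_cube_eq_zero
          (p := a 2) (q := a 0) (by simpa [h₁, add_comm] using hf) (by tauto)
        refine ⟨a 2, hμ, ω, hω, Or.inr (Or.inr ?_)⟩
        ext i; fin_cases i <;> simp [h₁, h]
    · obtain ⟨hμ, ω, hω, h⟩ := exists_cube_root_of_cube_add_cube_eq_zero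
        (p := a 0) (q := a 1) (by simpa [h₂] using hf) (by tauto)
      refine ⟨a 0, hμ, ω, hω, Or.inl ?_⟩
      ext i; fin_cases i <;> simp [h₂, h]
  · rintro ⟨μ, -, ω, hω, rfl | rfl | rfl⟩ <;>
      simp <;> linear_combination -μ ^ 3 * hω
end

section
/- Let K be a field and a, a′ ∈ K³ with a0a1a2 ≠ 0 and a0′a1′a2′ ≠ 0. Suppose there exist P, Q ∈ GL₃(K) with P·M_{a,x}·Q = M_{a′,x} as matrices over K[x0,x1,x2]. Then, with N1, N2 (resp. N1′, N2′) the matrices M0⁻¹M1, M0⁻¹M2 built from a (resp. a′) as in the decomposition M_{a,x} = M0x0+M1x1+M2x2, the pairs (N1,N2) and (N1′,N2′) are simultaneously conjugate (there is R ∈ GL₃(K) with N1′ = R N1 R⁻¹ and N2′ = R N2 R⁻¹), and in particular the three invariants coincide: (a0⁶+a1⁶+a2⁶)/(a0a1a2)² = (a0′⁶+a1′⁶+a2′⁶)/(a0′a1′a2′)², (a0³a1³+a0³a2³+a1³a2³)/(a0a1a2)² = (a0′³a1′³+a0′³a2′³+a1′³a2′³)/(a0′a1′a2′)², and (a0⁶a1³+a1⁶a2³+a2⁶a0³)/(a0a1a2)³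 = (a0′⁶a1′³+a1′⁶a2′³+a2′⁶a0′³)/(a0′a1′a2′)³. -/
open MvPolynomial Matrix

/-- The coefficient matrix `M_k` of `x_k` in the Moore matrix `M_{a,x}`. -/
def mcoef {K : Type*} [CommRing K] (a : Fin 3 → K) (k : Fin 3) :
    Matrix (Fin 3) (Fin 3) K :=
  Matrix.of fun i j => if i - j = k then a (i + j) else 0

theorem moore_X_map_eval_single {K : Type*} [CommRing K] (a : Fin 3 → K) (k : Fin 3) :
    (moore a fun i => X i).map (MvPolynomial.eval (Pi.single k 1)) = mcoef a k := by
  ext i j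
  simp [moore, mcoef, Pi.single_apply]

theorem mul_mcoef_mul_eq {K : Type*} [CommRing K] {a a' : Fin 3 → K}
    {P Q : Matrix (Fin 3) (Fin 3) K}
    (h : P.map MvPolynomial.C * (moore a fun i => X i) * Q.map MvPolynomial.C =
      (moore a' fun i => X i)) (k : Fin 3) :
    P * mcoef a k * Q = mcoef a' k := by
  have h1 := congrArg (fun M => M.map (MvPolynomial.eval (Pi.single k (1 : K)))) h
  have hC (A : Matrix (Fin 3) (Fin 3) K) :
      (A.map MvPolynomial.C).map (MvPolynomial.eval (Pi.single k (1 : K))) = A := by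
    ext i j
    simp
  simpa only [Matrix.map_mul, moore_X_map_eval_single, hC] using h1

theorem inv_mul_eq_conj_of_mul_mul_eq {n K : Type*} [Fintype n] [DecidableEq n] [CommRing K]
    {P Q A B A' B' : Matrix n n K} (hP : IsUnit P.det) (hQ : IsUnit Q.det)
    (hA : P * A * Q = A') (hB : P * B * Q = B') :
    A'⁻¹ * B' = Q⁻¹ * (A⁻¹ * B) * Q⁻¹⁻¹ := by
  rw [← hA, ← hB, Matrix.mul_inv_rev, Matrix.mul_inv_rev, Matrix.nonsing_inv_nonsing_inv Q hQ]
  simp only [Matrix.mul_assoc, Matrix.nonsing_inv_mul_cancel_left P _ hP]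

theorem inv_mcoef_zero {K : Type*} [Field K] {a : Fin 3 → K} (ha : a 0 * a 1 * a 2 ≠ 0) :
    (mcoef a 0)⁻¹ = Matrix.diagonal ![(a 0)⁻¹, (a 2)⁻¹, (a 1)⁻¹] := by
  obtain ⟨h01, h2⟩ := mul_ne_zero_iff.mp ha
  obtain ⟨h0, h1⟩ := mul_ne_zero_iff.mp h01
  refine Matrix.inv_eq_left_inv ?_
  ext i j
  fin_cases i <;> fin_cases j <;>
    simp [mcoef, Matrix.diagonal_mul, h0, h1, h2, Fin.ext_iff, Fin.sub_def, Fin.add_def]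

theorem inv_mcoef_zero_mul_one {K : Type*} [Field K] {a : Fin 3 → K}
    (ha : a 0 * a 1 * a 2 ≠ 0) :
    (mcoef a 0)⁻¹ * mcoef a 1 =
      !![0, 0, a 2 / a 0; a 1 / a 2, 0, 0; 0, a 0 / a 1, 0] := by
  rw [inv_mcoef_zero ha]
  ext i j
  fin_cases i <;> fin_cases j <;>
    simp [mcoef, Matrix.diagonal_mul, Fin.ext_iff, Fin.sub_def, Fin.add_def, div_eq_inv_mul]

theorem inv_mcoef_zero_mul_two {K : Type*} [Field K] {a : Fin 3 → K}
    (ha : a 0 * a 1 * a 2 ≠ 0) :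
    (mcoef a 0)⁻¹ * mcoef a 2 =
      !![0, a 1 / a 0, 0; 0, 0, a 0 / a 2; a 2 / a 1, 0, 0] := by
  rw [inv_mcoef_zero ha]
  ext i j
  fin_cases i <;> fin_cases j <;>
    simp [mcoef, Matrix.diagonal_mul, Fin.ext_iff, Fin.sub_def, Fin.add_def, div_eq_inv_mul]

section Invariants

variable {K : Type*} [Field K] {a : Fin 3 → K}

theorem trace_mul_mul_mul_mcoef (ha : a 0 * a 1 * a 2 ≠ 0)
    {A B : Matrix (Fin 3) (Fin 3) K} (hA : A = (mcoef a 0)⁻¹ * mcoef a 1)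
    (hB : B = (mcoef a 0)⁻¹ * mcoef a 2) :
    (A * B * (A * B)).trace = (a 0 ^ 6 + a 1 ^ 6 + a 2 ^ 6) / (a 0 * a 1 * a 2) ^ 2 := by
  obtain ⟨h01, h2⟩ := mul_ne_zero_iff.mp ha
  obtain ⟨h0, h1⟩ := mul_ne_zero_iff.mp h01
  rw [hA, hB, inv_mcoef_zero_mul_one ha, inv_mcoef_zero_mul_two ha]
  simp [Matrix.trace_fin_three]
  field_simp
  ring

theorem trace_mul_mul_swap_mcoef (ha : a 0 * a 1 * a 2 ≠ 0)
    {A B : Matrix (Fin 3) (Fin 3) K} (hA : A = (mcoef a 0)⁻¹ * mcoef a 1)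
    (hB : B = (mcoef a 0)⁻¹ * mcoef a 2) :
    (A * B * (B * A)).trace =
      (a 0 ^ 3 * a 1 ^ 3 + a 0 ^ 3 * a 2 ^ 3 + a 1 ^ 3 * a 2 ^ 3) / (a 0 * a 1 * a 2) ^ 2 := by
  obtain ⟨h01, h2⟩ := mul_ne_zero_iff.mp ha
  obtain ⟨h0, h1⟩ := mul_ne_zero_iff.mp h01
  rw [hA, hB, inv_mcoef_zero_mul_one ha, inv_mcoef_zero_mul_two ha]
  simp [Matrix.trace_fin_three]
  field_simp
  ring

theorem trace_mul_mul_swap_mul_swap_mcoef (ha : a 0 * a 1 * a 2 ≠ 0)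
    {A B : Matrix (Fin 3) (Fin 3) K} (hA : A = (mcoef a 0)⁻¹ * mcoef a 1)
    (hB : B = (mcoef a 0)⁻¹ * mcoef a 2) :
    (A * B * (B * A) * (B * A)).trace =
      (a 0 ^ 6 * a 1 ^ 3 + a 1 ^ 6 * a 2 ^ 3 + a 2 ^ 6 * a 0 ^ 3) /
        (a 0 * a 1 * a 2) ^ 3 := by
  obtain ⟨h01, h2⟩ := mul_ne_zero_iff.mp ha
  obtain ⟨h0, h1⟩ := mul_ne_zero_iff.mp h01
  rw [hA, hB, inv_mcoef_zero_mul_one ha, inv_mcoef_zero_mul_two ha]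
  simp [Matrix.trace_fin_three]
  field_simp
  ring

end Invariants

theorem conj_mul_conj {n K : Type*} [Fintype n] [DecidableEq n] [CommRing K]
    {R : Matrix n n K} (hR : IsUnit R.det) (A B : Matrix n n K) :
    R * A * R⁻¹ * (R * B * R⁻¹) = R * (A * B) * R⁻¹ := by
  simp only [Matrix.mul_assoc, Matrix.nonsing_inv_mul_cancel_left R _ hR]

theorem trace_conj_of_isUnit_det {n K : Type*} [Fintype n] [DecidableEq n] [CommRing K]
    {R : Matrix n n K} (hR : IsUnit R.det) (A : Matrix n n K) :
    (R * A * R⁻¹).trace = A.trace := by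
  rw [Matrix.trace_mul_comm, Matrix.nonsing_inv_mul_cancel_left R _ hR]

theorem equivalent_moore_matrices_simultaneous_conjugation {K : Type*} [Field K]
    (a a' : Fin 3 → K) (ha : a 0 * a 1 * a 2 ≠ 0) (ha' : a' 0 * a' 1 * a' 2 ≠ 0)
    (P Q : Matrix (Fin 3) (Fin 3) K) (hP : IsUnit P.det) (hQ : IsUnit Q.det)
    (h : P.map MvPolynomial.C * (moore a fun i => X i) * Q.map MvPolynomial.C =
      (moore a' fun i => X i)) :
    (∃ R : Matrix (Fin 3) (Fin 3) K, IsUnit R.det ∧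
        (mcoef a' 0)⁻¹ * mcoef a' 1 = R * ((mcoef a 0)⁻¹ * mcoef a 1) * R⁻¹ ∧
        (mcoef a' 0)⁻¹ * mcoef a' 2 = R * ((mcoef a 0)⁻¹ * mcoef a 2) * R⁻¹) ∧
    (a 0 ^ 6 + a 1 ^ 6 + a 2 ^ 6) / (a 0 * a 1 * a 2) ^ 2 =
        (a' 0 ^ 6 + a' 1 ^ 6 + a' 2 ^ 6) / (a' 0 * a' 1 * a' 2) ^ 2 ∧
    (a 0 ^ 3 * a 1 ^ 3 + a 0 ^ 3 * a 2 ^ 3 + a 1 ^ 3 * a 2 ^ 3) /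
        (a 0 * a 1 * a 2) ^ 2 =
      (a' 0 ^ 3 * a' 1 ^ 3 + a' 0 ^ 3 * a' 2 ^ 3 + a' 1 ^ 3 * a' 2 ^ 3) /
        (a' 0 * a' 1 * a' 2) ^ 2 ∧
    (a 0 ^ 6 * a 1 ^ 3 + a 1 ^ 6 * a 2 ^ 3 + a 2 ^ 6 * a 0 ^ 3) /
        (a 0 * a 1 * a 2) ^ 3 =
      (a' 0 ^ 6 * a' 1 ^ 3 + a' 1 ^ 6 * a' 2 ^ 3 + a' 2 ^ 6 * a' 0 ^ 3) /
        (a' 0 * a' 1 * a' 2) ^ 3 := by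
  have hR : IsUnit (Q⁻¹).det := Matrix.isUnit_nonsing_inv_det Q hQ
  have hc (k : Fin 3) := inv_mul_eq_conj_of_mul_mul_eq hP hQ
    (mul_mcoef_mul_eq h 0) (mul_mcoef_mul_eq h k)
  refine ⟨⟨Q⁻¹, hR, hc 1, hc 2⟩, ?_, ?_, ?_⟩
  · rw [← trace_mul_mul_mul_mcoef ha rfl rfl, ← trace_mul_mul_mul_mcoef ha' rfl rfl, hc 1, hc 2]
    simp only [conj_mul_conj hR, trace_conj_of_isUnit_det hR]
  · rw [← trace_mul_mul_swap_mcoef ha rfl rfl, ← trace_mul_mul_swap_mcoef ha' rfl rfl, hc 1, hc 2]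
    simp only [conj_mul_conj hR, trace_conj_of_isUnit_det hR]
  · rw [← trace_mul_mul_swap_mul_swap_mcoef ha rfl rfl, ← trace_mul_mul_swap_mul_swap_mcoef ha' rfl rfl,
      hc 1, hc 2]
    simp only [conj_mul_conj hR, trace_conj_of_isUnit_det hR]
end

section
/- Let K be a field, n = d·m with d, m ≥ 1 and gcd(d, m) = 1, and let ζ ∈ K be a primitive n-th root of unity. Let Σ_n ∈ GL_n(K) be the cyclic shift matrix with Σ_n·e_i = e_{(i−1) mod n} and, for j ∈ ℤ, let T_{n,j} = diag(ζ^{i·j})_{i=0,…,n−1}. Then there exists a single P ∈ GL_n(K) such that P·Σ_n^m·P⁻¹ is the block-diagonal direct sum of m copies of Σ_d, and P·T_{n,j}^m·P⁻¹ is the block-diagonal direct sum of m copies of the d×d diagonal matrix diag((ζ^m)^{j·m·α})_{α=0,…,d−1}. Equivalently, the restriction of the Schrödinger representation ρ_j of the Heisenberg group H_n along the homomorphism H_d → H_n sending σ ↦ σ^m, τ ↦ τ^m is isomorphic to the direct sum of m = n/d copies of the Schrödinger representation ρ_{(j·n/d) mod d} of H_d. -/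
open Matrix

/-- The cyclic shift matrix `Σ_N` with `Σ_N · e_i = e_{(i-1) mod N}`. -/
def cshift (K : Type*) [CommRing K] (N : ℕ) : Matrix (Fin N) (Fin N) K :=
  Matrix.of fun i j => if (j : ℕ) = ((i : ℕ) + 1) % N then 1 else 0

/-- The diagonal matrix `T_{N,j} = diag(ζ^{i·j})_{i=0,…,N−1}`. -/
def tdiag {K : Type*} [CommRing K] (zeta : K) (N j : ℕ) : Matrix (Fin N) (Fin N) K :=
  Matrix.diagonal fun i : Fin N => zeta ^ ((i : ℕ) * j)

/-- The entries of a power of the cyclic shift matrix. -/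
theorem cshift_pow_apply (K : Type*) [CommRing K] (N k : ℕ) (i l : Fin N) :
    (cshift K N ^ k) i l = if (l : ℕ) = ((i : ℕ) + k) % N then 1 else 0 := by
  induction k generalizing i with
  | zero => simp [Matrix.one_apply, Fin.ext_iff, Nat.mod_eq_of_lt i.isLt, eq_comm]
  | succ k ih =>
    have hN : 0 < N := i.pos
    rw [pow_succ', Matrix.mul_apply,
      Finset.sum_eq_single (⟨((i : ℕ) + 1) % N, Nat.mod_lt _ hN⟩ : Fin N)]
    · rw [ih]
      simp [cshift, add_comm k 1, ← add_assoc]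
    · intro b _ hb
      have hb' : (b : ℕ) ≠ ((i : ℕ) + 1) % N := fun h => hb (Fin.ext h)
      simp [cshift, hb']
    · simp

/-- The residue of `m * α + d * q` modulo `d * m`. -/
def crtIndex (d m : ℕ) (hd : 0 < d) (hm : 0 < m) (p : Fin d × Fin m) : Fin (d * m) :=
  ⟨(m * (p.1 : ℕ) + d * (p.2 : ℕ)) % (d * m), Nat.mod_lt _ (Nat.mul_pos hd hm)⟩

theorem crtIndex_injective (d m : ℕ) (hd : 0 < d) (hm : 0 < m) (hgcd : Nat.gcd d m = 1) :
    Function.Injective (crtIndex d m hd hm) := by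
  rintro ⟨a, q⟩ ⟨a', q'⟩ h
  have h : m * (a : ℕ) + d * q ≡ m * a' + d * q' [MOD d * m] := congrArg Fin.val h
  have h₁ : m * (a : ℕ) ≡ m * a' [MOD d] := by
    simpa [Nat.ModEq, Nat.add_mul_mod_self_left] using h.of_mul_right m
  have h₂ : d * (q : ℕ) ≡ d * q' [MOD m] := by
    simpa [Nat.ModEq, Nat.mul_add_mod] using h.of_mul_left d
  have ha := Nat.ModEq.cancel_left_of_coprime hgcd h₁
  have hq := Nat.ModEq.cancel_left_of_coprime (by rwa [Nat.gcd_comm]) h₂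
  exact Prod.ext (Fin.ext (ha.eq_of_lt_of_lt a.isLt a'.isLt))
    (Fin.ext (hq.eq_of_lt_of_lt q.isLt q'.isLt))

/-- `crtIndex` as an equivalence. -/
noncomputable def crtIndexEquiv (d m : ℕ) (hd : 0 < d) (hm : 0 < m) (hgcd : Nat.gcd d m = 1) :
    Fin d × Fin m ≃ Fin (d * m) :=
  Equiv.ofBijective (crtIndex d m hd hm)
    ((Fintype.bijective_iff_injective_and_card _).2
      ⟨crtIndex_injective d m hd hm hgcd, by simp⟩)

theorem crtIndex_add_mod (d m : ℕ) (hd : 0 < d) (hm : 0 < m) (a : Fin d) (q : Fin m) :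
    ((crtIndex d m hd hm (a, q) : ℕ) + m) % (d * m) =
      crtIndex d m hd hm (⟨((a : ℕ) + 1) % d, Nat.mod_lt _ hd⟩, q) := by
  have h : m * ((a : ℕ) + 1) ≡ m * (((a : ℕ) + 1) % d) [MOD d * m] := by
    rw [mul_comm d m]
    exact ((Nat.mod_modEq _ _).symm).mul_left' m
  have h' := h.add_right (d * (q : ℕ))
  simp only [crtIndex, Nat.mod_add_mod]
  rw [← h']
  congr 1
  ring

theorem cshift_pow_submatrix_crtIndex (K : Type*) [CommRing K] (d m : ℕ) (hd : 0 < d)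
    (hm : 0 < m) (hgcd : Nat.gcd d m = 1) :
    (cshift K (d * m) ^ m).submatrix (crtIndex d m hd hm) (crtIndex d m hd hm) =
      Matrix.blockDiagonal fun _ : Fin m => cshift K d := by
  ext ⟨a, q⟩ ⟨a', q'⟩
  rw [Matrix.submatrix_apply, cshift_pow_apply, crtIndex_add_mod, Matrix.blockDiagonal_apply]
  simp only [← Fin.ext_iff, (crtIndex_injective d m hd hm hgcd).eq_iff]
  by_cases hq : q = q' <;> simp [cshift, Fin.ext_iff, hq, eq_comm]

theorem tdiag_pow_submatrix_crtIndex {K : Type*} [CommRing K] (d m : ℕ) (hd : 0 < d)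
    (hm : 0 < m) (hgcd : Nat.gcd d m = 1) (zeta : K) (hzeta : zeta ^ (d * m) = 1) (j : ℕ) :
    (tdiag zeta (d * m) j ^ m).submatrix (crtIndex d m hd hm) (crtIndex d m hd hm) =
      Matrix.blockDiagonal fun _ : Fin m =>
        Matrix.diagonal fun α : Fin d => (zeta ^ m) ^ (j * m * (α : ℕ)) := by
  rw [tdiag, Matrix.diagonal_pow, Matrix.submatrix_diagonal _ _
    (crtIndex_injective d m hd hm hgcd), Matrix.blockDiagonal_diagonal]
  congr 1
  ext ⟨a, q⟩
  simp only [Function.comp_apply, Pi.pow_apply, crtIndex]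
  rw [pow_mul, ← pow_eq_pow_mod _ hzeta]
  calc ((zeta ^ (m * (a : ℕ) + d * q)) ^ j) ^ m
      = (zeta ^ m) ^ (j * m * (a : ℕ)) * (zeta ^ (d * m)) ^ ((q : ℕ) * j) := by ring
    _ = (zeta ^ m) ^ (j * m * (a : ℕ)) := by rw [hzeta, one_pow, mul_one]

/-- Relabelling the basis by a permutation is conjugation by an invertible matrix. -/
theorem exists_forall_conj_eq_submatrix (K : Type*) [CommRing K] {ι : Type*} [Fintype ι]
    [DecidableEq ι] (e : ι ≃ ι) :
    ∃ P : Matrix ι ι K, IsUnit P.det ∧ ∀ A : Matrix ι ι K, P * A * P⁻¹ = A.submatrix e e := by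
  have h : (1 : Matrix ι ι K).submatrix e id * (1 : Matrix ι ι K).submatrix id e = 1 := by
    rw [← Matrix.submatrix_mul _ _ _ _ _ Function.bijective_id, mul_one,
      Matrix.submatrix_one_equiv]
  refine ⟨(1 : Matrix ι ι K).submatrix e id, Matrix.isUnit_det_of_right_inverse h, fun A => ?_⟩
  rw [Matrix.inv_eq_right_inv h]
  conv_lhs => rw [← Matrix.submatrix_id_id A]
  rw [← Matrix.submatrix_mul _ _ _ _ _ Function.bijective_id,
    ← Matrix.submatrix_mul _ _ _ _ _ Function.bijective_id, one_mul, mul_one]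

/-- Restriction of the Schrödinger representation `ρ_j` of `H_{dm}` to `H_d`
(via `σ ↦ σ^m`, `τ ↦ τ^m`) is simultaneously conjugate to the direct sum of `m`
copies of the Schrödinger representation `ρ_{jm mod d}` of `H_d`. -/
theorem schroedinger_restriction_decomposition {K : Type*} [Field K]
    (d m : ℕ) (hd : 0 < d) (hm : 0 < m) (hgcd : Nat.gcd d m = 1)
    (zeta : K) (hzeta : IsPrimitiveRoot zeta (d * m)) (j : ℕ) :
    ∃ P : Matrix (Fin (d * m)) (Fin (d * m)) K, IsUnit P.det ∧
      P * cshift K (d * m) ^ m * P⁻¹ =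
        Matrix.reindex finProdFinEquiv finProdFinEquiv
          (Matrix.blockDiagonal fun _ : Fin m => cshift K d) ∧
      P * tdiag zeta (d * m) j ^ m * P⁻¹ =
        Matrix.reindex finProdFinEquiv finProdFinEquiv
          (Matrix.blockDiagonal fun _ : Fin m =>
            Matrix.diagonal fun α : Fin d => (zeta ^ m) ^ (j * m * (α : ℕ))) := by
  obtain ⟨P, hP, hconj⟩ := exists_forall_conj_eq_submatrix K
    (finProdFinEquiv.symm.trans (crtIndexEquiv d m hd hm hgcd))
  refine ⟨P, hP, ?_, ?_⟩
  · rw [hconj, ← cshift_pow_submatrix_crtIndex K d m hd hm hgcd]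
    rfl
  · rw [hconj, ← tdiag_pow_submatrix_crtIndex d m hd hm hgcd zeta hzeta.pow_eq_one j]
    rfl
end

section
/- Let S be a commutative ring, f ∈ S a non-zero-divisor, n ≥ 1, and A, B ∈ Mat_n(S) with A·B = f·I_n = B·A. For a matrix C ∈ Mat_n(S) the following are equivalent: (a) there exists D ∈ Mat_n(S) with A·D + C·B = 0; (b) there exists D′ ∈ Mat_n(S) with D′·A + B·C = 0; (c) every entry of B·C·B is divisible by f. If these hold, then the matrices D and D′ are unique, equal to each other, and equal to the unique matrix satisfying f·D = −B·C·B; moreover C is recovered from D as the unique matrix with f·C = −A·D·A. -/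
open Matrix

theorem Matrix.smul_left_cancel_of_mem_nonZeroDivisors {S m k : Type*} [CommRing S] {f : S}
    (hf : f ∈ nonZeroDivisors S) {X Y : Matrix m k S} (h : f • X = f • Y) : X = Y := by
  ext i j
  have hij : f * X i j = f * Y i j := congrFun (congrFun h i) j
  exact (mul_cancel_left_mem_nonZeroDivisors hf).1 hij

section

variable {S ι : Type*} [CommRing S] [Fintype ι] [DecidableEq ι] {f : S} {A B : Matrix ι ι S}

theorem mul_add_mul_eq_zero_iff_smul_eq (hf : f ∈ nonZeroDivisors S)
    (hAB : A * B = f • (1 : Matrix ι ι S)) (hBA : B * A = f • (1 : Matrix ι ι S))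
    (C D : Matrix ι ι S) : A * D + C * B = 0 ↔ f • D = -(B * C * B) := by
  constructor
  · intro h
    rw [eq_neg_iff_add_eq_zero]
    calc f • D + B * C * B = B * A * D + B * C * B := by rw [hBA, smul_mul_assoc, one_mul]
      _ = B * (A * D + C * B) := by noncomm_ring
      _ = 0 := by rw [h, mul_zero]
  · intro h
    apply Matrix.smul_left_cancel_of_mem_nonZeroDivisors hf
    calc f • (A * D + C * B) = A * (f • D) + f • (C * B) := by rw [smul_add, mul_smul_comm]
      _ = -(A * B * (C * B)) + f • (C * B) := by rw [h]; noncomm_ring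
      _ = f • (0 : Matrix ι ι S) := by
        rw [hAB, smul_mul_assoc, one_mul, neg_add_cancel, smul_zero]

theorem mul_add_mul_eq_zero_iff_smul_eq' (hf : f ∈ nonZeroDivisors S)
    (hAB : A * B = f • (1 : Matrix ι ι S)) (hBA : B * A = f • (1 : Matrix ι ι S))
    (C D : Matrix ι ι S) : D * A + B * C = 0 ↔ f • D = -(B * C * B) := by
  constructor
  · intro h
    rw [eq_neg_iff_add_eq_zero]
    calc f • D + B * C * B = D * (A * B) + B * C * B := by rw [hAB, mul_smul_comm, mul_one]
      _ = (D * A + B * C) * B := by noncomm_ring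
      _ = 0 := by rw [h, zero_mul]
  · intro h
    apply Matrix.smul_left_cancel_of_mem_nonZeroDivisors hf
    calc f • (D * A + B * C) = (f • D) * A + f • (B * C) := by rw [smul_add, smul_mul_assoc]
      _ = -(B * C * (B * A)) + f • (B * C) := by rw [h]; noncomm_ring
      _ = f • (0 : Matrix ι ι S) := by
        rw [hBA, mul_smul_comm, mul_one, neg_add_cancel, smul_zero]

end

theorem Matrix.exists_smul_eq_neg_iff_forall_dvd {S m k : Type*} [CommRing S] (f : S)
    (X : Matrix m k S) : (∃ D : Matrix m k S, f • D = -X) ↔ ∀ i j, f ∣ X i j := by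
  constructor
  · rintro ⟨D, hD⟩ i j
    have hij : f * D i j = -X i j := congrFun (congrFun hD i) j
    exact (dvd_neg).1 ⟨D i j, hij.symm⟩
  · intro h
    choose E hE using h
    refine ⟨-Matrix.of E, ?_⟩
    ext i j
    simp [hE i j]

theorem matrix_factorization_extension_equations {S : Type*} [CommRing S]
    (f : S) (hf : f ∈ nonZeroDivisors S) (n : ℕ) (hn : 1 ≤ n)
    (A B : Matrix (Fin n) (Fin n) S)
    (hAB : A * B = f • (1 : Matrix (Fin n) (Fin n) S))
    (hBA : B * A = f • (1 : Matrix (Fin n) (Fin n) S))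
    (C : Matrix (Fin n) (Fin n) S) :
    ((∃ D, A * D + C * B = 0) ↔ (∃ D', D' * A + B * C = 0)) ∧
    ((∃ D, A * D + C * B = 0) ↔ ∀ i j, f ∣ (B * C * B) i j) ∧
    (∀ D D', A * D + C * B = 0 → D' * A + B * C = 0 →
        D = D' ∧ f • D = -(B * C * B) ∧ f • C = -(A * D * A)) ∧
    (∀ D₁ D₂, A * D₁ + C * B = 0 → A * D₂ + C * B = 0 → D₁ = D₂) ∧
    (∀ D₁ D₂, D₁ * A + B * C = 0 → D₂ * A + B * C = 0 → D₁ = D₂) := by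
  have ha := mul_add_mul_eq_zero_iff_smul_eq hf hAB hBA C
  have hb := mul_add_mul_eq_zero_iff_smul_eq' hf hAB hBA C
  have cancel {X Y : Matrix (Fin n) (Fin n) S} {Z} (hX : f • X = Z) (hY : f • Y = Z) : X = Y :=
    Matrix.smul_left_cancel_of_mem_nonZeroDivisors hf (hX.trans hY.symm)
  refine ⟨by simp only [ha, hb], ?_, ?_, ?_, ?_⟩
  · simp only [ha, Matrix.exists_smul_eq_neg_iff_forall_dvd]
  · intro D D' h h'
    refine ⟨cancel ((ha D).1 h) ((hb D').1 h'), (ha D).1 h, ?_⟩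
    rw [eq_neg_of_add_eq_zero_left h, neg_mul, neg_neg, mul_assoc, hBA, mul_smul_comm, mul_one]
  · exact fun D₁ D₂ h₁ h₂ => cancel ((ha D₁).1 h₁) ((ha D₂).1 h₂)
  · exact fun D₁ D₂ h₁ h₂ => cancel ((hb D₁).1 h₁) ((hb D₂).1 h₂)
end

section
/- Let K be an algebraically closed field, S = K[x1,…,xn] a polynomial ring, and A ∈ Mat_m(S) a square matrix whose determinant f = det A is nonzero and squarefree (i.e. f is reduced). Set B = adj A, the adjugate of A. Then for every matrix C ∈ Mat_m(S): (i) B·C·B ≡ tr(B·C)·B modulo f, entrywise; and (ii) f divides every entry of B·C·B if and only if f divides tr(B·C). -/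
open Matrix MvPolynomial

section

variable {ι R : Type*} [Fintype ι] [DecidableEq ι] [CommRing R]

/-- Replacing two columns of the identity matrix by `u` and `v` yields a matrix whose determinant
is a `2 × 2` minor of the matrix with columns `u` and `v`. -/
theorem Matrix.det_one_updateCol_updateCol {i l : ι} (h : i ≠ l) (u v : ι → R) :
    (((1 : Matrix ι ι R).updateCol i u).updateCol l v).det = u i * v l - u l * v i := by
  have hN : ((1 : Matrix ι ι R).updateCol i u).updateCol l v =
      1 + (Matrix.of fun a => ![u a - (1 : Matrix ι ι R) a i, v a - (1 : Matrix ι ι R) a l]) *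
        (Matrix.of ![(1 : Matrix ι ι R) i, (1 : Matrix ι ι R) l]) := by
    ext a b
    by_cases hl : b = l
    · subst hl
      simp [Matrix.mul_apply, Fin.sum_univ_two, Matrix.one_apply_ne h]
    · by_cases hi : b = i
      · subst hi
        simp [Matrix.mul_apply, Fin.sum_univ_two, h,
          Matrix.one_apply_ne h.symm]
      · simp [Matrix.mul_apply, Fin.sum_univ_two, hl, hi,
          Matrix.one_apply_ne (Ne.symm hl), Matrix.one_apply_ne (Ne.symm hi)]
  rw [hN, Matrix.det_one_add_mul_comm, Matrix.det_fin_two]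
  simp [Matrix.vecMul, dotProduct, Matrix.one_apply, h, h.symm]
  ring

/-- The `2 × 2` minors of the adjugate are divisible by the determinant. -/
theorem Matrix.det_dvd_adjugate_minor [IsDomain R] {A : Matrix ι ι R} (hA : A.det ≠ 0)
    (i l k j : ι) :
    A.det ∣ A.adjugate i k * A.adjugate l j - A.adjugate l k * A.adjugate i j := by
  rcases eq_or_ne i l with rfl | h
  · simp
  have hcol (c : ι) : A *ᵥ A.adjugate.col c = A.det • (Pi.single c 1 : ι → R) := by
    ext a
    have := congrFun (congrFun A.mul_adjugate a) c
    simpa [Matrix.mul_apply, Matrix.mulVec, dotProduct, Matrix.one_apply, Pi.single_apply]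
      using this
  have hprod : A * ((1 : Matrix ι ι R).updateCol i (A.adjugate.col k)).updateCol l
      (A.adjugate.col j) =
      (A.updateCol i (A.det • Pi.single k 1)).updateCol l (A.det • Pi.single j 1) := by
    rw [Matrix.mul_updateCol, Matrix.mul_updateCol, mul_one, hcol, hcol]
  have hdet := congrArg Matrix.det hprod
  rw [Matrix.det_mul, Matrix.det_one_updateCol_updateCol h, Matrix.det_updateCol_smul,
    Matrix.updateCol_comm _ h, Matrix.det_updateCol_smul] at hdet
  exact ⟨_, mul_left_cancel₀ hA hdet⟩

/-- Modulo `det A`, one has `adj A * C * adj A = tr (adj A * C) • adj A`. -/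
theorem Matrix.det_dvd_adjugate_mul_mul_adjugate_sub [IsDomain R] {A : Matrix ι ι R}
    (hA : A.det ≠ 0) (C : Matrix ι ι R) (i j : ι) :
    A.det ∣ (A.adjugate * C * A.adjugate) i j -
      Matrix.trace (A.adjugate * C) * A.adjugate i j := by
  have h : (A.adjugate * C * A.adjugate) i j -
      Matrix.trace (A.adjugate * C) * A.adjugate i j =
      ∑ l, ∑ k, C k l *
        (A.adjugate i k * A.adjugate l j - A.adjugate l k * A.adjugate i j) := by
    simp only [Matrix.mul_apply, Matrix.trace, Matrix.diag_apply, Finset.sum_mul,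
      ← Finset.sum_sub_distrib]
    refine Finset.sum_congr rfl fun l _ => Finset.sum_congr rfl fun k _ => ?_
    ring
  rw [h]
  exact Finset.dvd_sum fun l _ => Finset.dvd_sum fun k _ =>
    (Matrix.det_dvd_adjugate_minor hA i l k j).mul_left _

/-- If `det A` is radical, a scalar `t` is divisible by `det A` as soon as `t • adj A` is. -/
theorem Matrix.det_dvd_of_dvd_mul_adjugate [IsDomain R] {A : Matrix ι ι R} (hA : A.det ≠ 0)
    (hrad : IsRadical A.det) {t : R} (h : ∀ i j, A.det ∣ t * A.adjugate i j) : A.det ∣ t := by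
  cases isEmpty_or_nonempty ι
  · simp
  choose D hD using h
  have hmat : t • A.adjugate = A.det • Matrix.of D := by
    ext i j
    simpa using hD i j
  have hdet := congrArg Matrix.det hmat
  rw [Matrix.det_smul, Matrix.det_smul, Matrix.det_adjugate,
    ← Nat.sub_add_cancel (Fintype.card_pos (α := ι)), Nat.add_sub_cancel, pow_succ A.det] at hdet
  exact hrad _ t ⟨_, mul_left_cancel₀ (pow_ne_zero _ hA)
    ((mul_comm _ _).trans (hdet.trans (mul_assoc _ _ _)))⟩

end

theorem adjugate_sandwich_trace_criterion {K : Type*} [Field K] [IsAlgClosed K]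
    (n m : ℕ) (A : Matrix (Fin m) (Fin m) (MvPolynomial (Fin n) K))
    (hne : A.det ≠ 0) (hsf : Squarefree A.det)
    (C : Matrix (Fin m) (Fin m) (MvPolynomial (Fin n) K)) :
    (∀ i j, A.det ∣
        ((A.adjugate * C * A.adjugate) i j -
          Matrix.trace (A.adjugate * C) * A.adjugate i j)) ∧
    ((∀ i j, A.det ∣ (A.adjugate * C * A.adjugate) i j) ↔
        A.det ∣ Matrix.trace (A.adjugate * C)) := by
  have hcongr := Matrix.det_dvd_adjugate_mul_mul_adjugate_sub hne C
  refine ⟨hcongr, fun h => ?_, fun h i j => ?_⟩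
  · exact Matrix.det_dvd_of_dvd_mul_adjugate hne hsf.isRadical fun i j =>
      (dvd_iff_dvd_of_dvd_sub (hcongr i j)).1 (h i j)
  · exact (dvd_iff_dvd_of_dvd_sub (hcongr i j)).2 (h.mul_right _)
end

section
/- Let K be a field and a = (a0,a1,a2) ∈ K³ with a0a1a2 ≠ 0 and with a0³, a1³, a2³ not all equal (equivalently, the doubling vector b = b(a) is nonzero). Suppose y = (y0,y1,y2) is a triple of homogeneous linear forms in K[x0,x1,x2] and U, V ∈ Mat₃(K) are constant matrices such that M_{b,y} = U·M_{a,x} − M_{a,x}·V. Then the divergence of M_{b,y} vanishes: ∂y0/∂x0 + ∂y1/∂x1 + ∂y2/∂x2 = 0. -/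
open MvPolynomial Matrix

/-- The doubling vector of `a` is proportional to `a` only if the cubes of the entries of `a`
coincide. -/
lemma cubes_eq_of_dbl_proportional {K : Type*} [Field K] (a : Fin 3 → K)
    (ha : a 0 * a 1 * a 2 ≠ 0) (h₁ : a 1 * dbl a 0 = a 0 * dbl a 1)
    (h₂ : a 2 * dbl a 0 = a 0 * dbl a 2) :
    a 0 ^ 3 = a 1 ^ 3 ∧ a 1 ^ 3 = a 2 ^ 3 := by
  obtain ⟨⟨h0, h1⟩, h2⟩ : (a 0 ≠ 0 ∧ a 1 ≠ 0) ∧ a 2 ≠ 0 := by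
    simpa only [mul_ne_zero_iff] using ha
  have e₁ : a 1 * (a 2 ^ 3 - a 1 ^ 3) = a 2 * (a 1 ^ 3 - a 0 ^ 3) := by
    refine mul_left_cancel₀ h0 ?_
    simp only [dbl, cons_val] at h₁
    linear_combination h₁
  have e₂ : a 2 * (a 2 ^ 3 - a 1 ^ 3) = a 1 * (a 0 ^ 3 - a 2 ^ 3) := by
    refine mul_left_cancel₀ h0 ?_
    simp only [dbl, cons_val] at h₂
    linear_combination h₂
  have hw : a 2 ^ 3 - a 1 ^ 3 = 0 := by
    refine pow_eq_zero_iff two_ne_zero |>.mp ?_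
    linear_combination (a 2 - a 1) * (a 1 * e₁ + a 2 * e₂)
  have hp : a 1 ^ 3 - a 0 ^ 3 = 0 := by
    refine mul_left_cancel₀ h2 ?_
    linear_combination a 1 * hw - e₁
  exact ⟨(sub_eq_zero.mp hp).symm, (sub_eq_zero.mp hw).symm⟩

/-- Differentiating the `(i, j)` entry of the coboundary equation with respect to `x_{i-j}` only
sees the diagonal entries `U i i` and `V j j`. -/
lemma pderiv_of_moore_eq_coboundary {K : Type*} [CommRing K] (a b : Fin 3 → K)
    (y : Fin 3 → MvPolynomial (Fin 3) K) (U V : Matrix (Fin 3) (Fin 3) K)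
    (h : moore b y =
        U.map MvPolynomial.C * (moore a fun i => X i) -
          (moore a fun i => X i) * V.map MvPolynomial.C) (i j : Fin 3) :
    C (b (i + j)) * pderiv (i - j) (y (i - j)) = C (a (i + j)) * (C (U i i) - C (V j j)) := by
  have hij := congrArg (pderiv (i - j)) (congrFun (congrFun h i) j)
  have hX (k l : Fin 3) : pderiv k (X l : MvPolynomial (Fin 3) K) = if l = k then 1 else 0 := by
    rw [pderiv_X, Pi.single_apply]
  simp only [moore, Matrix.sub_apply, Matrix.mul_apply, Matrix.of_apply, Matrix.map_apply,
    map_sub, map_sum, Derivation.leibniz, pderiv_C, hX, smul_eq_mul, mul_zero, add_zero,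
    zero_add, sub_left_inj, sub_right_inj, mul_ite, mul_one, Finset.sum_ite_eq',
    Finset.mem_univ, if_true] at hij
  rw [hij]
  ring

theorem divergence_vanishes_on_coboundaries {K : Type*} [Field K] (a : Fin 3 → K)
    (ha : a 0 * a 1 * a 2 ≠ 0)
    (hne : ¬(a 0 ^ 3 = a 1 ^ 3 ∧ a 1 ^ 3 = a 2 ^ 3))
    (y : Fin 3 → MvPolynomial (Fin 3) K) (hy : ∀ i, (y i).IsHomogeneous 1)
    (U V : Matrix (Fin 3) (Fin 3) K)
    (h : moore (dbl a) y =
        U.map MvPolynomial.C * (moore a fun i => X i) -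
          (moore a fun i => X i) * V.map MvPolynomial.C) :
    pderiv (0 : Fin 3) (y 0) + pderiv (1 : Fin 3) (y 1) + pderiv (2 : Fin 3) (y 2) = 0 := by
  have key {i j s d : Fin 3} (hs : i + j = s) (hd : i - j = d) :
      C (dbl a s) * pderiv d (y d) = C (a s) * (C (U i i) - C (V j j)) := by
    subst hs hd
    exact pderiv_of_moore_eq_coboundary a (dbl a) y U V h i j
  set D := pderiv (0 : Fin 3) (y 0) + pderiv (1 : Fin 3) (y 1) + pderiv (2 : Fin 3) (y 2) with hD
  have trace_eq (s : Fin 3) : C (dbl a s) * D =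
      C (a s) * (C U.trace - C V.trace) := by
    simp only [Matrix.trace_fin_three, map_add, hD]
    match s with
    | 0 =>
      linear_combination key (i := 0) (j := 0) (s := 0) (d := 0) rfl rfl +
        key (i := 1) (j := 2) (s := 0) (d := 2) rfl rfl +
        key (i := 2) (j := 1) (s := 0) (d := 1) rfl rfl
    | 1 =>
      linear_combination key (i := 0) (j := 1) (s := 1) (d := 2) rfl rfl +
        key (i := 1) (j := 0) (s := 1) (d := 1) rfl rfl +
        key (i := 2) (j := 2) (s := 1) (d := 0) rfl rfl
    | 2 =>
      linear_combination key (i := 0) (j := 2) (s := 2) (d := 1) rfl rfl +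
        key (i := 1) (j := 1) (s := 2) (d := 0) rfl rfl +
        key (i := 2) (j := 0) (s := 2) (d := 2) rfl rfl
  by_contra hD0
  have proportional (s : Fin 3) : a s * dbl a 0 = a 0 * dbl a s := by
    apply C_injective (Fin 3) K
    refine mul_right_cancel₀ hD0 ?_
    simp only [map_mul]
    linear_combination C (a s) * trace_eq 0 - C (a 0) * trace_eq s
  exact hne (cubes_eq_of_dbl_proportional a ha (proportional 1) (proportional 2))
end
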